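/- For i = 1,…,n let A_i ∈ ℝ^{d×m}, let φ_i : ℝ^m → ℝ be convex, differentiable and (1/γ)-smooth (γ > 0), and set f_i(x) := φ_i(A_iᵀ x), f := (1/n) Σ_{i=1}^n f_i (so ∇f_i(x) = A_i ∇φ_i(A_iᵀ x)). Let a sampling with weights p_C be given with marginals p_i := Σ_{C : i∈C} p_C > 0, and suppose the ESO inequality holds: for all h_1,…,h_n ∈ ℝ^m, E_S ‖Σ_{i∈S} A_i h_i‖² ≤ Σ_{i=1}^n p_i v_i ‖h_i‖². Then for all x, y ∈ ℝ^d: E_S ‖(1/n) Σ_{i∈S} (1/p_i)(∇f_i(x) − ∇f_i(y))‖² ≤ (2/(nγ)) max_{i∈[n]} (v_i/p_i) · (f(x) − f(y) − ⟨∇f(y), x − y⟩). -/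

import Mathlib

open scoped RealInnerProductSpace BigOperators

lemma aux_line {E : Type*} [NormedAddCommGroup E] [InnerProductSpace ℝ E] [CompleteSpace E]
    (f : E → ℝ) (f' : E → E) (hg : ∀ u, HasGradientAt f (f' u) u) (a w : E) (t : ℝ) :
    HasDerivAt (fun t : ℝ => f (a + t • w)) (inner ℝ (f' (a + t • w)) w) t := by
  have h1 : HasDerivAt (fun t : ℝ => a + t • w) w t := by
    simpa using ((hasDerivAt_id t).smul_const w).const_add a
  have h2 := (hg (a + t • w)).hasFDerivAt.comp_hasDerivAt t h1
  simp only [InnerProductSpace.toDual_apply_apply] at h2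
  exact h2

lemma aux_convex {E : Type*} [NormedAddCommGroup E] [InnerProductSpace ℝ E] [CompleteSpace E]
    (f : E → ℝ) (f' : E → E) (hc : ConvexOn ℝ Set.univ f)
    (hg : ∀ u, HasGradientAt f (f' u) u) (b z : E) :
    f b + inner ℝ (f' b) (z - b) ≤ f z := by
  have hd := aux_line f f' hg b (z - b) 0
  have hcl : ConvexOn ℝ Set.univ (fun t : ℝ => f (b + t • (z - b))) := by
    have := hc.comp_affineMap (AffineMap.lineMap b z : ℝ →ᵃ[ℝ] E)
    refine (this.congr ?_)
    intro t _
    simp [AffineMap.lineMap_apply, add_comm]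
  have := hcl.le_slope_of_hasDerivAt (Set.mem_univ 0) (Set.mem_univ 1) one_pos hd
  simp [slope_def_field] at this
  linarith

lemma aux_descent {E : Type*} [NormedAddCommGroup E] [InnerProductSpace ℝ E] [CompleteSpace E]
    (f : E → ℝ) (f' : E → E) (L : ℝ) (hL : 0 ≤ L)
    (hg : ∀ u, HasGradientAt f (f' u) u) (hs : LipschitzWith (Real.toNNReal L) f') (a w : E) :
    f (a + w) ≤ f a + inner ℝ (f' a) w + L / 2 * ‖w‖ ^ 2 := by
  have hd : ∀ t : ℝ, HasDerivAt (fun t : ℝ => f (a + t • w) - t * inner ℝ (f' a) w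
      - t ^ 2 * (L / 2 * ‖w‖ ^ 2))
      (inner ℝ (f' (a + t • w)) w - 1 * inner ℝ (f' a) w - (2 * t) * (L / 2 * ‖w‖ ^ 2)) t := by
    intro t
    refine ((aux_line f f' hg a w t).sub ((hasDerivAt_id t).mul_const _)).sub
      (HasDerivAt.mul_const ?_ _)
    simpa using hasDerivAt_pow 2 t
  have han : AntitoneOn (fun t : ℝ => f (a + t • w) - t * inner ℝ (f' a) w
      - t ^ 2 * (L / 2 * ‖w‖ ^ 2)) (Set.Icc 0 1) := by
    refine antitoneOn_of_deriv_nonpos (convex_Icc 0 1)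
      (fun t _ => (hd t).continuousAt.continuousWithinAt)
      (fun t _ => (hd t).differentiableAt.differentiableWithinAt) ?_
    intro t ht
    rw [interior_Icc] at ht
    rw [(hd t).deriv]
    have h1 : inner ℝ (f' (a + t • w) - f' a) w ≤ ‖f' (a + t • w) - f' a‖ * ‖w‖ :=
      real_inner_le_norm _ _
    have h2 : ‖f' (a + t • w) - f' a‖ ≤ L * (t * ‖w‖) := by
      have := hs.norm_sub_le (a + t • w) a
      simpa [norm_smul, abs_of_pos ht.1, Real.coe_toNNReal L hL] using this
    have h3 := mul_le_mul_of_nonneg_right h2 (norm_nonneg w)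
    rw [inner_sub_left] at h1
    nlinarith
  have := han (Set.left_mem_Icc.mpr zero_le_one) (Set.right_mem_Icc.mpr zero_le_one) zero_le_one
  simp at this
  linarith

lemma aux_coco {E : Type*} [NormedAddCommGroup E] [InnerProductSpace ℝ E] [CompleteSpace E]
    (f : E → ℝ) (f' : E → E) (γ : ℝ) (hγ : 0 < γ) (hc : ConvexOn ℝ Set.univ f)
    (hg : ∀ u, HasGradientAt f (f' u) u) (hs : LipschitzWith (Real.toNNReal (1 / γ)) f')
    (a b : E) :
    ‖f' a - f' b‖ ^ 2 ≤ 2 / γ * (f a - f b - inner ℝ (f' b) (a - b)) := by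
  have h1 := aux_descent f f' (1 / γ) (by positivity) hg hs a (-(γ • (f' a - f' b)))
  have h2 := aux_convex f f' hc hg b (a + -(γ • (f' a - f' b)))
  have e1 : a + -(γ • (f' a - f' b)) - b = (a - b) - γ • (f' a - f' b) := by abel
  rw [e1, inner_sub_right, inner_smul_right] at h2
  rw [inner_neg_right, inner_smul_right, norm_neg, norm_smul, Real.norm_of_nonneg hγ.le] at h1
  have h3 : inner ℝ (f' a) (f' a - f' b) - inner ℝ (f' b) (f' a - f' b)
      = ‖f' a - f' b‖ ^ 2 := by
    rw [← inner_sub_left, real_inner_self_eq_norm_sq]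
  have h4 : 1 / γ / 2 * (γ * ‖f' a - f' b‖) ^ 2 = γ / 2 * ‖f' a - f' b‖ ^ 2 := by
    field_simp
  rw [h4] at h1
  rw [div_mul_eq_mul_div, le_div_iff₀ hγ]
  nlinarith

/-- Lemma `esoexp` of the paper: ESO parameters bound the expected
smoothness constant.  Here `f_i(x) = φ_i(A_iᵀ x)` with `A_iᵀ` the adjoint of `A_i`,
so `∇f_i(x) = A_i ∇φ_i(A_iᵀ x)`. -/
theorem eso_expected_smoothness
    {d m n : ℕ} (hn : 0 < n)
    (γ : ℝ) (hγ : 0 < γ)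
    (φ : Fin n → EuclideanSpace ℝ (Fin m) → ℝ)
    (φ' : Fin n → EuclideanSpace ℝ (Fin m) → EuclideanSpace ℝ (Fin m))
    (hφconv : ∀ i, ConvexOn ℝ Set.univ (φ i))
    (hφgrad : ∀ i u, HasGradientAt (φ i) (φ' i u) u)
    (hφsmooth : ∀ i, LipschitzWith (Real.toNNReal (1 / γ)) (φ' i))
    (A : Fin n → EuclideanSpace ℝ (Fin m) →L[ℝ] EuclideanSpace ℝ (Fin d))
    -- sampling, with positive marginals pm i = P[i ∈ S]
    (pC : Finset (Fin n) → ℝ) (hpC : ∀ C, 0 ≤ pC C) (hpCsum : ∑ C, pC C = 1)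
    (pm : Fin n → ℝ)
    (hpm : ∀ i, pm i = ∑ C ∈ Finset.univ.filter (fun C => i ∈ C), pC C)
    (hpm0 : ∀ i, 0 < pm i)
    -- the ESO inequality
    (v : Fin n → ℝ)
    (hESO : ∀ h : Fin n → EuclideanSpace ℝ (Fin m),
      ∑ C, pC C * ‖∑ i ∈ C, A i (h i)‖ ^ 2 ≤ ∑ i, pm i * v i * ‖h i‖ ^ 2)
    (x y : EuclideanSpace ℝ (Fin d)) :
    ∑ C, pC C * ‖(n : ℝ)⁻¹ • ∑ i ∈ C, (pm i)⁻¹ •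
          (A i (φ' i (ContinuousLinearMap.adjoint (A i) x))
            - A i (φ' i (ContinuousLinearMap.adjoint (A i) y)))‖ ^ 2
      ≤ 2 / ((n : ℝ) * γ) *
          (Finset.univ.sup' (Finset.univ_nonempty_iff.mpr (Fin.pos_iff_nonempty.mp hn))
            (fun i => v i / pm i))
        * ((n : ℝ)⁻¹ * ∑ i, φ i (ContinuousLinearMap.adjoint (A i) x)
            - (n : ℝ)⁻¹ * ∑ i, φ i (ContinuousLinearMap.adjoint (A i) y)
            - ⟪(n : ℝ)⁻¹ • ∑ i, A i (φ' i (ContinuousLinearMap.adjoint (A i) y)),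
                x - y⟫) := by
  have hnR : (0 : ℝ) < n := by exact_mod_cast hn
  set M := Finset.univ.sup' (Finset.univ_nonempty_iff.mpr (Fin.pos_iff_nonempty.mp hn))
            (fun i => v i / pm i) with hM
  have hvM : ∀ i, v i / pm i ≤ M := fun i =>
    Finset.le_sup' (fun i => v i / pm i) (Finset.mem_univ i)
  set X := fun i => ContinuousLinearMap.adjoint (A i) x with hX
  set Y := fun i => ContinuousLinearMap.adjoint (A i) y with hY
  set D := fun i => φ i (X i) - φ i (Y i) - inner ℝ (φ' i (Y i)) (X i - Y i) with hD
  have hcoco : ∀ i, ‖φ' i (X i) - φ' i (Y i)‖ ^ 2 ≤ 2 / γ * D i := fun i =>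
    aux_coco (φ i) (φ' i) γ hγ (hφconv i) (hφgrad i) (hφsmooth i) (X i) (Y i)
  have hRHS : ((n : ℝ)⁻¹ * ∑ i, φ i (X i) - (n : ℝ)⁻¹ * ∑ i, φ i (Y i)
            - ⟪(n : ℝ)⁻¹ • ∑ i, A i (φ' i (Y i)), x - y⟫) = (n : ℝ)⁻¹ * ∑ i, D i := by
    simp only [hD, Finset.sum_sub_distrib, mul_sub, inner_smul_left, sum_inner]
    simp [hX, hY, ← map_sub, ContinuousLinearMap.adjoint_inner_right]
  have hES := hESO (fun i => ((n : ℝ)⁻¹ * (pm i)⁻¹) • (φ' i (X i) - φ' i (Y i)))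
  have hLHS : ∀ C : Finset (Fin n), (n : ℝ)⁻¹ • ∑ i ∈ C, (pm i)⁻¹ •
      (A i (φ' i (X i)) - A i (φ' i (Y i)))
      = ∑ i ∈ C, A i (((n : ℝ)⁻¹ * (pm i)⁻¹) • (φ' i (X i) - φ' i (Y i))) := by
    intro C
    simp [Finset.smul_sum, mul_smul]
  have key : ∀ i, M * ‖φ' i (X i) - φ' i (Y i)‖ ^ 2 ≤ M * (2 / γ * D i) := by
    intro i
    rcases le_or_gt 0 M with h0 | h0
    · exact mul_le_mul_of_nonneg_left (hcoco i) h0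
    · have hv : ∀ j, v j < 0 := fun j => by
        have := (hvM j).trans_lt h0
        rw [div_lt_iff₀ (hpm0 j)] at this
        simpa using this
      have hz : ∀ w : EuclideanSpace ℝ (Fin m), w = 0 := by
        intro w
        by_contra hw
        have hw' : 0 < ‖w‖ := norm_pos_iff.mpr hw
        have h1 := hESO (fun _ => w)
        have h2 : (0 : ℝ) ≤ ∑ C, pC C * ‖∑ i ∈ C, A i w‖ ^ 2 :=
          Finset.sum_nonneg fun C _ => mul_nonneg (hpC C) (by positivity)
        have h3 : ∑ j, pm j * v j * ‖w‖ ^ 2 < 0 :=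
          Finset.sum_neg (fun j _ => mul_neg_of_neg_of_pos
            (mul_neg_of_pos_of_neg (hpm0 j) (hv j)) (by positivity)) ⟨i, Finset.mem_univ i⟩
        linarith
      have e1 : X i = Y i := (hz _).trans (hz _).symm
      simp [hD, e1]
  simp only [hX, hY] at hRHS hLHS
  rw [hRHS]
  simp only [hLHS]
  refine hES.trans ?_
  have : 2 / ((n : ℝ) * γ) * M * ((n : ℝ)⁻¹ * ∑ i, D i)
      = ∑ i, ((n : ℝ)⁻¹) ^ 2 * (M * (2 / γ * D i)) := by
    rw [← Finset.mul_sum, ← Finset.mul_sum, ← Finset.mul_sum]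
    field_simp
  rw [this]
  refine Finset.sum_le_sum fun i _ => ?_
  have hp := hpm0 i
  have e : pm i * v i * ‖((n : ℝ)⁻¹ * (pm i)⁻¹) • (φ' i (X i) - φ' i (Y i))‖ ^ 2
      = ((n : ℝ)⁻¹) ^ 2 * (v i / pm i * ‖φ' i (X i) - φ' i (Y i)‖ ^ 2) := by
    rw [norm_smul, Real.norm_of_nonneg (by positivity)]
    field_simp
  rw [e]
  refine mul_le_mul_of_nonneg_left (le_trans ?_ (key i)) (by positivity)
  exact mul_le_mul_of_nonneg_right (hvM i) (by positivity)
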